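/- arXiv:2601.07950 — 5 statements merged into one kernel-verified Lean document; each statement's English description precedes it below -/
import Mathlib

section
/- Let m and M be positive integers with ρ(m,M) = 2. Then D(⟦-m,M⟧) = m + M - 2. -/
def IsMinZeroSum (S : Multiset ℤ) : Prop :=
  S.sum = 0 ∧ ∀ T : Multiset ℤ, T ≤ S → T ≠ 0 → T ≠ S → T.sum ≠ 0

noncomputable def davenport (m M : ℕ) : ℕ :=
  sSup {n : ℕ | ∃ S : Multiset ℤ, IsMinZeroSum S ∧
    (∀ x ∈ S, -(m : ℤ) ≤ x ∧ x ≤ (M : ℤ)) ∧ S.card = n}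

noncomputable def rho (m M : ℕ) : ℕ :=
  sInf {t : ℕ | ∃ t' : ℕ, t' ≤ t ∧
    Int.gcd ((M : ℤ) - (t' : ℤ)) ((m : ℤ) - ((t - t' : ℕ) : ℤ)) = 1}

lemma sum_nonpos_of_forall_nonpos {T : Multiset ℤ} (h : ∀ x ∈ T, x ≤ 0) : T.sum ≤ 0 := by
  have : 0 ≤ (T.map (fun x => -x)).sum := Multiset.sum_nonneg fun x hx => by
    obtain ⟨z, hz, rfl⟩ := Multiset.mem_map.1 hx
    have := h z hz
    omega
  rw [Multiset.sum_map_neg'] at this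
  simpa using this

lemma injOn_sum_take {G : Type*} [AddCommGroup G] (l : List G)
    (h : ∀ T : Multiset G, T ≤ l → T ≠ 0 → T ≠ l → T.sum ≠ 0) :
    Set.InjOn (fun k => (l.take k).sum) (Set.Iio l.length) := by
  have key : ∀ i j, i < j → j < l.length → (l.take i).sum ≠ (l.take j).sum := by
    intro i j hij hj heq
    have hlen : ((l.take j).drop i).length = j - i := by
      rw [List.length_drop, List.length_take]; omega
    have hsub : ((l.take j).drop i).Sublist l :=
      (List.drop_sublist _ _).trans (List.take_sublist _ _)
    refine h ((l.take j).drop i : List G) hsub.subperm ?_ ?_ ?_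
    · intro h0
      have := congrArg Multiset.card h0
      simp only [Multiset.coe_card, Multiset.card_zero] at this
      omega
    · intro h0
      have := congrArg Multiset.card h0
      simp only [Multiset.coe_card] at this
      omega
    · have h1 : (l.take j).sum = ((l.take j).take i).sum + ((l.take j).drop i).sum := by
        rw [← List.sum_append, List.take_append_drop]
      rw [List.take_take, min_eq_left hij.le, heq] at h1
      simpa using h1
  intro i hi j hj hij
  rcases lt_trichotomy i j with h1 | h1 | h1
  · exact absurd hij (key i j h1 hj)
  · exact h1
  · exact absurd hij.symm (key j i h1 hi)

/-- An ordering in which negative terms are used exactly when the running sum is positive. -/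
lemma exists_bounded_ordering (M : ℤ) (S : Multiset ℤ) :
    ∀ s : ℤ, s ≤ M → s + S.sum = 0 → 0 ∉ S → (∀ x ∈ S, x ≤ M) →
      ∃ l : List ℤ, (l : Multiset ℤ) = S ∧ ∀ k (hk : k < l.length),
        s + (l.take k).sum ≤ M ∧ (0 < s + (l.take k).sum ↔ l[k] < 0) := by
  induction hn : S.card generalizing S with
  | zero =>
    intro s _ _ _ _
    rw [Multiset.card_eq_zero] at hn
    exact ⟨[], by simp [hn], by simp⟩
  | succ n ih =>
    intro s hs hsum h0 hM
    have hex : ∃ x ∈ S, (0 < s ↔ x < 0) := by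
      by_contra! hcon
      have hS : S ≠ 0 := by rintro rfl; simp at hn
      by_cases hs0 : 0 < s
      · have : 0 ≤ S.sum := Multiset.sum_nonneg fun x hx => by
          rcases hcon x hx with h | h <;> omega
        omega
      · obtain ⟨y, hy⟩ := Multiset.exists_mem_of_ne_zero hS
        have hneg : ∀ x ∈ S, x < 0 := fun x hx => by
          rcases hcon x hx with h | h <;> omega
        obtain ⟨T, rfl⟩ := Multiset.exists_cons_of_mem hy
        have : T.sum ≤ 0 := sum_nonpos_of_forall_nonpos fun x hx =>
          (hneg x (Multiset.mem_cons_of_mem hx)).le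
        have := hneg y hy
        rw [Multiset.sum_cons] at hsum
        omega
    obtain ⟨x, hx, hxs⟩ := hex
    obtain ⟨T, rfl⟩ := Multiset.exists_cons_of_mem hx
    have hx0 : x ≠ 0 := fun h => h0 (h ▸ hx)
    have hxM := hM x hx
    rw [Multiset.sum_cons] at hsum
    obtain ⟨l, hl, hw⟩ := ih T (by simpa using hn) (s + x) (by omega) (by omega)
      (fun h => h0 (Multiset.mem_cons_of_mem h)) fun y hy => hM y (Multiset.mem_cons_of_mem hy)
    refine ⟨x :: l, by rw [← hl, Multiset.cons_coe], fun k hk => ?_⟩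
    cases k with
    | zero => simpa using ⟨hs, hxs⟩
    | succ k => simpa [add_assoc] using hw k (by simpa using hk)

lemma card_filter_neg_le {M : ℤ} {S : Multiset ℤ} (hS : IsMinZeroSum S) (h0 : 0 ∉ S)
    (hM : ∀ x ∈ S, x ≤ M) {x : ℤ} (hx : x ∈ S) (hxpos : 0 < x) :
    ((S.filter (· < 0)).card : ℤ) ≤ M ∧ (((S.filter (· < 0)).card : ℤ) = M → x = M) := by
  obtain ⟨T, rfl⟩ := Multiset.exists_cons_of_mem hx
  have hsum := hS.1
  rw [Multiset.sum_cons] at hsum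
  obtain ⟨l', hl', hw'⟩ := exists_bounded_ordering M T x (hM x hx) hsum
    (fun h => h0 (Multiset.mem_cons_of_mem h)) fun y hy => hM y (Multiset.mem_cons_of_mem hy)
  obtain ⟨l, rfl⟩ : ∃ l, l = x :: l' := ⟨_, rfl⟩
  have hxM := hM x hx
  have hl : ((x :: l' : List ℤ) : Multiset ℤ) = x ::ₘ T := by rw [← hl', Multiset.cons_coe]
  have hw : ∀ k (hk : k < (x :: l').length), ((x :: l').take k).sum ≤ M ∧
      (0 < ((x :: l').take k).sum ↔ (x :: l')[k] < 0) := by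
    intro k hk
    cases k with
    | zero => simp; omega
    | succ k => simpa using hw' k (by simpa using hk)
  have hinj := injOn_sum_take (x :: l') (by rw [hl]; exact hS.2)
  rw [← hl]
  generalize hL : x :: l' = l at *
  let I : Finset (Fin l.length) := Finset.univ.filter fun k => l.get k < 0
  have hI : ((l : Multiset ℤ).filter (· < 0)).card = I.card := by
    have : (l : Multiset ℤ) = (Finset.univ : Finset (Fin l.length)).val.map l.get := by
      rw [Fin.univ_val_map, List.ofFn_get]
    rw [this, ← Multiset.countP_eq_card_filter, Multiset.countP_map]
    rfl
  let f : Fin l.length → ℤ := fun k => (l.take k).sum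
  have hf : Function.Injective f := fun i j hij => Fin.ext (hinj i.2 j.2 hij)
  have hsub : I.image f ⊆ Finset.Icc 1 M := by
    intro p hp
    obtain ⟨k, hk, rfl⟩ := Finset.mem_image.1 hp
    have hk' : l[(k : ℕ)] < 0 := (Finset.mem_filter.1 hk).2
    obtain ⟨h1, h2⟩ := hw k k.2
    exact Finset.mem_Icc.2 ⟨h2.2 hk', h1⟩
  have hcard : (I.image f).card = I.card := Finset.card_image_of_injective _ hf
  have hIcc : ((Finset.Icc 1 M).card : ℤ) = M := by
    rw [Int.card_Icc]; omega
  rw [hI]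
  refine ⟨?_, fun heq => ?_⟩
  · rw [← hcard, ← hIcc]; exact_mod_cast Finset.card_le_card hsub
  · have hfull : I.image f = Finset.Icc 1 M := Finset.eq_of_subset_of_card_le hsub (by omega)
    have hmem : M ∈ I.image f := by rw [hfull, Finset.mem_Icc]; omega
    obtain ⟨⟨k, hk⟩, -, hkM⟩ := Finset.mem_image.1 hmem
    have hkM : (l.take k).sum = M := hkM
    cases k with
    | zero => simp at hkM; omega
    | succ k =>
      have hk' : k < l.length := by omega
      obtain ⟨h1, h2⟩ := hw k hk'
      have h3 : (l.take (k + 1)).sum = (l.take k).sum + l[k] := by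
        rw [List.take_succ_eq_append_getElem hk', List.sum_append]; simp
      have h4 : l[k] ≤ M := hM _ (by rw [← hl]; exact List.getElem_mem hk')
      have h5 : (l.take k).sum = (l.take 0).sum := by simp; omega
      have h6 : k = 0 := hinj hk' (by simp; omega) h5
      subst h6
      subst hL
      simpa using hkM

lemma eq_of_mem_of_card_eq {a : ℕ} (ha : 1 < a) {N : Multiset (ZMod a)} (hcard : N.card = a)
    (hN : ∀ T ≤ N, T ≠ 0 → T ≠ N → T.sum ≠ 0) {z w : ZMod a} (hz : z ∈ N) (hw : w ∈ N) :
    w = z := by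
  have : NeZero a := ⟨by omega⟩
  by_cases hwz : w = z
  · exact hwz
  obtain ⟨N₁, rfl⟩ := Multiset.exists_cons_of_mem hz
  obtain ⟨N₂, rfl⟩ := Multiset.exists_cons_of_mem ((Multiset.mem_cons.1 hw).resolve_left hwz)
  obtain ⟨l, rfl⟩ : ∃ l : List (ZMod a), (l : Multiset (ZMod a)) = N₂ := Quot.exists_rep N₂
  have hinj := injOn_sum_take (z :: w :: l) hN
  have hlen : (z :: w :: l).length = a := hcard
  have hlen' : l.length + 2 = a := by simpa using hlen
  have hbij : Function.Bijective fun k : Fin a => ((z :: w :: l).take k).sum := by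
    rw [Fintype.bijective_iff_injective_and_card]
    refine ⟨fun i j hij => Fin.ext (hinj ?_ ?_ hij), by simp [ZMod.card]⟩
    · rw [hlen]; exact i.2
    · rw [hlen]; exact j.2
  obtain ⟨⟨k, hk⟩, hkw⟩ := hbij.2 w
  match k, hk, hkw with
  | 0, _, hkw =>
    refine absurd hkw.symm ?_
    have := hN {w} (by simp) (by simp) (fun h => by
      have := congrArg Multiset.card h
      simp at this)
    simpa using this
  | 1, _, hkw => simpa using hkw.symm
  | k + 2, hk, hkw =>
    have h1 : z + (l.take k).sum = 0 := by
      have : z + (w + (l.take k).sum) = w := by simpa using hkw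
      linear_combination this
    refine absurd h1 ?_
    have := hN (z ::ₘ (l.take k : List (ZMod a)))
      ((Multiset.cons_le_cons_iff z).2
        ((Multiset.coe_le.2 (List.take_sublist k l).subperm).trans (Multiset.le_cons_self _ w)))
      (by simp) (fun h => by
        have := congrArg Multiset.card h
        simp at this
        omega)
    simpa using this

lemma exists_le_of_le_map {α β : Type*} {f : α → β} {N : Multiset α} {T : Multiset β}
    (h : T ≤ N.map f) : ∃ T' ≤ N, T'.map f = T := by
  induction N using Quot.inductionOn with | _ l => ?_
  induction T using Quot.inductionOn with | _ t => ?_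
  obtain ⟨t', ht', hsub⟩ := Multiset.coe_le.1 h
  obtain ⟨l', hl', rfl⟩ := List.sublist_map_iff.1 hsub
  exact ⟨l', Multiset.coe_le.2 hl'.subperm, Multiset.coe_eq_coe.2 ht'⟩

lemma gcd_eq_one_of_nsmul_ne_zero {a : ℕ} (ha : 0 < a) {y : ℤ}
    (h : ∀ k : ℕ, 0 < k → k < a → (k : ZMod a) * (y : ZMod a) ≠ 0) : Int.gcd a y = 1 := by
  by_contra hd
  obtain ⟨k, hk⟩ : Int.gcd a y ∣ a := by exact_mod_cast Int.gcd_dvd_left (a : ℤ) y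
  obtain ⟨c, hc⟩ : (Int.gcd a y : ℤ) ∣ y := Int.gcd_dvd_right (a : ℤ) y
  generalize Int.gcd a y = d at *
  have hk0 : 0 < k := Nat.pos_of_ne_zero (by rintro rfl; omega)
  have hd0 : d ≠ 0 := by rintro rfl; omega
  refine h k hk0 (by rw [hk]; nlinarith [show 2 ≤ d by omega]) ?_
  have : ((k * y : ℤ) : ZMod a) = 0 := by
    rw [ZMod.intCast_zmod_eq_zero_iff_dvd, hc]
    exact ⟨c, by rw [hk]; push_cast; ring⟩
  exact_mod_cast this

lemma filter_pos_add_filter_neg {S : Multiset ℤ} (h0 : 0 ∉ S) :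
    S.filter (0 < ·) + S.filter (· < 0) = S := by
  conv_rhs => rw [← Multiset.filter_add_not (0 < ·) S]
  congr 1
  refine Multiset.filter_congr fun x hx => ?_
  have : x ≠ 0 := fun h => h0 (h ▸ hx)
  omega

lemma gcd_eq_one_of_card_filter_neg_eq {M : ℕ} (hM1 : 1 < M) {S : Multiset ℤ}
    (hS : IsMinZeroSum S) (h0 : 0 ∉ S) (hM : ∀ x ∈ S, x ≤ M)
    (hcard : (S.filter (· < 0)).card = M) {y : ℤ} (hy : y ∈ S) (hy0 : y < 0) :
    Int.gcd M y = 1 := by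
  have hpos : S.filter (0 < ·) = Multiset.replicate (S.filter (0 < ·)).card (M : ℤ) := by
    refine Multiset.eq_replicate_card.2 fun x hx => ?_
    obtain ⟨hxS, hx0⟩ := Multiset.mem_filter.1 hx
    exact (card_filter_neg_le hS h0 hM hxS hx0).2 (by exact_mod_cast hcard)
  have hsplit := filter_pos_add_filter_neg h0
  have hyN : y ∈ S.filter (· < 0) := Multiset.mem_filter.2 ⟨hy, hy0⟩
  have hneg : ∀ x ∈ S.filter (· < 0), x < 0 := fun x hx => (Multiset.mem_filter.1 hx).2
  generalize S.filter (0 < ·) = P at *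
  generalize S.filter (· < 0) = N at *
  generalize P.card = p at *
  subst hpos hsplit
  have hsum := hS.1
  rw [Multiset.sum_add, Multiset.sum_replicate, nsmul_eq_mul] at hsum
  have hnonpos : ∀ T ≤ N, T.sum ≤ 0 := fun T hT =>
    sum_nonpos_of_forall_nonpos fun x hx => (hneg x (Multiset.mem_of_le hT hx)).le
  have hfree : ∀ T ≤ N, T ≠ 0 → T ≠ N → ¬ (M : ℤ) ∣ T.sum := by
    rintro T hT hT0 hTN ⟨c, hc⟩
    have hM0 : (0 : ℤ) < M := by omega
    have hc0 : c ≤ 0 := by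
      have := hnonpos T hT
      by_contra! hcon
      nlinarith
    have hcp : -c ≤ p := by
      obtain ⟨U, rfl⟩ := Multiset.le_iff_exists_add.1 hT
      have hU := hnonpos U (Multiset.le_add_left _ _)
      rw [Multiset.sum_add] at hsum
      by_contra! hcon
      nlinarith
    obtain ⟨k, rfl⟩ : ∃ k : ℕ, c = -k := ⟨c.natAbs, by omega⟩
    refine hS.2 (Multiset.replicate k (M : ℤ) + T)
      (add_le_add (Multiset.replicate_le_replicate _ |>.2 (by omega)) hT) ?_ ?_ ?_
    · simp [hT0]
    · intro h
      have h1 := congrArg (Multiset.filter (· < 0)) h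
      have h2 : ∀ j, (Multiset.replicate j (M : ℤ)).filter (· < 0) = 0 := fun j =>
        Multiset.filter_eq_nil.2 fun x hx => by
          rw [Multiset.eq_of_mem_replicate hx]; omega
      rw [Multiset.filter_add, Multiset.filter_add, h2, h2, zero_add, zero_add,
        Multiset.filter_eq_self.2 hneg,
        Multiset.filter_eq_self.2 fun x hx => hneg x (Multiset.mem_of_le hT hx)] at h1
      exact hTN h1
    · rw [Multiset.sum_add, Multiset.sum_replicate, nsmul_eq_mul, hc]
      ring
  let f : ℤ → ZMod M := fun x => x
  have hfsum : ∀ T : Multiset ℤ, (T.map f).sum = (T.sum : ZMod M) := fun T =>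
    (map_multiset_sum (Int.castRingHom (ZMod M)) T).symm
  have hfreeM : ∀ T ≤ N.map f, T ≠ 0 → T ≠ N.map f → T.sum ≠ 0 := by
    intro T hT hT0 hTN hTs
    obtain ⟨T', hT', rfl⟩ := exists_le_of_le_map hT
    rw [hfsum, ZMod.intCast_zmod_eq_zero_iff_dvd] at hTs
    exact hfree T' hT' (by rintro rfl; exact hT0 rfl) (by rintro rfl; exact hTN rfl) hTs
  have hcardM : (N.map f).card = M := by rw [Multiset.card_map, hcard]
  have hrep : N.map f = Multiset.replicate M (y : ZMod M) :=
    Multiset.eq_replicate.2 ⟨hcardM, fun z hz =>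
      eq_of_mem_of_card_eq hM1 hcardM hfreeM (Multiset.mem_map_of_mem f hyN) hz⟩
  refine gcd_eq_one_of_nsmul_ne_zero (by omega) fun k hk0 hkM => ?_
  have := hfreeM (Multiset.replicate k (y : ZMod M))
    (by rw [hrep]; exact (Multiset.replicate_le_replicate _).2 hkM.le)
    (fun h => by
      have := congrArg Multiset.card h
      simp at this
      omega)
    (fun h => by
      have := congrArg Multiset.card h
      rw [hcardM, Multiset.card_replicate] at this
      omega)
  rwa [Multiset.sum_replicate, nsmul_eq_mul] at this

lemma IsMinZeroSum.map_neg {S : Multiset ℤ} (hS : IsMinZeroSum S) :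
    IsMinZeroSum (S.map Neg.neg) := by
  have hsum : ∀ T : Multiset ℤ, (T.map Neg.neg).sum = -T.sum := fun T => Multiset.sum_map_neg' T
  refine ⟨by rw [hsum, hS.1, neg_zero], fun T hT hT0 hTS => ?_⟩
  obtain ⟨U, hU, rfl⟩ := exists_le_of_le_map hT
  rw [hsum, neg_ne_zero]
  exact hS.2 U hU (by rintro rfl; exact hT0 rfl) (by rintro rfl; exact hTS rfl)

lemma card_filter_neg_map_neg (S : Multiset ℤ) :
    ((S.map Neg.neg).filter (· < 0)).card = (S.filter (0 < ·)).card := by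
  simp [Multiset.filter_map]

lemma card_filter_pos_map_neg (S : Multiset ℤ) :
    ((S.map Neg.neg).filter (0 < ·)).card = (S.filter (· < 0)).card := by
  simp [Multiset.filter_map]

lemma zero_notMem_map_neg {S : Multiset ℤ} (h0 : 0 ∉ S) : 0 ∉ S.map Neg.neg := by
  simpa using h0

lemma card_filter_pos_le {m : ℤ} {S : Multiset ℤ} (hS : IsMinZeroSum S) (h0 : 0 ∉ S)
    (hm : ∀ x ∈ S, -m ≤ x) {y : ℤ} (hy : y ∈ S) (hy0 : y < 0) :
    ((S.filter (0 < ·)).card : ℤ) ≤ m := by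
  rw [← card_filter_neg_map_neg]
  refine (card_filter_neg_le hS.map_neg (zero_notMem_map_neg h0) ?_
    (Multiset.mem_map_of_mem _ hy) (by omega)).1
  intro x hx
  obtain ⟨z, hz, rfl⟩ := Multiset.mem_map.1 hx
  have := hm z hz
  omega

lemma gcd_eq_one_or_of_card_filter_neg_eq {m M : ℕ} (hM1 : 1 < M) {S : Multiset ℤ}
    (hS : IsMinZeroSum S) (h0 : 0 ∉ S) (hmM : ∀ x ∈ S, -(m : ℤ) ≤ x ∧ x ≤ M)
    (hneg : (S.filter (· < 0)).card = M) (hpos : m ≤ (S.filter (0 < ·)).card + 1) :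
    Int.gcd M m = 1 ∨ Int.gcd M (m - 1) = 1 := by
  obtain ⟨w, hw⟩ : ∃ w, w ∈ S.filter (· < 0) :=
    Multiset.card_pos_iff_exists_mem.1 (by omega)
  obtain ⟨hwS, hw0⟩ := Multiset.mem_filter.1 hw
  obtain ⟨y, hy, hmin⟩ := S.toFinset.exists_min_image id ⟨w, Multiset.mem_toFinset.2 hwS⟩
  rw [Multiset.mem_toFinset] at hy
  have hy0 : y < 0 := (hmin w (Multiset.mem_toFinset.2 hwS)).trans_lt hw0
  have hgcd := gcd_eq_one_of_card_filter_neg_eq hM1 hS h0 (fun x hx => (hmM x hx).2) hneg hy hy0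
  have hle := card_filter_pos_le (m := -y) hS h0
    (fun x hx => by simpa using hmin x (Multiset.mem_toFinset.2 hx)) hy hy0
  have hym := (hmM y hy).1
  rw [← Int.gcd_neg] at hgcd
  rcases (by omega : -y = m ∨ -y = m - 1) with h | h
  · exact Or.inl (h ▸ hgcd)
  · exact Or.inr (h ▸ hgcd)

lemma card_le_of_isMinZeroSum {m M : ℕ} (hm : 1 < m) (hM : 1 < M) (h00 : Int.gcd M m ≠ 1)
    (h01 : Int.gcd M (m - 1) ≠ 1) (h10 : Int.gcd (M - 1) m ≠ 1) {S : Multiset ℤ}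
    (hS : IsMinZeroSum S) (hmM : ∀ x ∈ S, -(m : ℤ) ≤ x ∧ x ≤ M) : S.card + 2 ≤ m + M := by
  by_cases h0 : 0 ∈ S
  · have hS0 : {0} = S := by
      by_contra h
      exact hS.2 {0} (by simpa using h0) (by simp) h (by simp)
    rw [← hS0, Multiset.card_singleton]
    omega
  have hsplit := filter_pos_add_filter_neg h0
  have hcard := congrArg Multiset.card hsplit
  rw [Multiset.card_add] at hcard
  have hbound : (S.filter (· < 0)).card ≤ M ∧ (S.filter (0 < ·)).card ≤ m := by
    by_cases hp : ∃ x ∈ S, 0 < x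
    · obtain ⟨x, hx, hx0⟩ := hp
      by_cases hn : ∃ y ∈ S, y < 0
      · obtain ⟨y, hy, hy0⟩ := hn
        exact ⟨by exact_mod_cast (card_filter_neg_le hS h0 (fun x hx => (hmM x hx).2) hx hx0).1,
          by exact_mod_cast card_filter_pos_le hS h0 (fun x hx => (hmM x hx).1) hy hy0⟩
      · push Not at hn
        obtain ⟨T, rfl⟩ := Multiset.exists_cons_of_mem hx
        have hT : 0 ≤ T.sum := Multiset.sum_nonneg fun z hz => hn z (Multiset.mem_cons_of_mem hz)
        have := hS.1
        rw [Multiset.sum_cons] at this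
        omega
    · push Not at hp
      suffices S = 0 by simp [this]
      refine Multiset.eq_zero_of_forall_notMem fun y hy => ?_
      have hy0 : y ≠ 0 := fun h => h0 (h ▸ hy)
      have hyp := hp y hy
      obtain ⟨T, rfl⟩ := Multiset.exists_cons_of_mem hy
      have hT : T.sum ≤ 0 :=
        sum_nonpos_of_forall_nonpos fun z hz => hp z (Multiset.mem_cons_of_mem hz)
      have := hS.1
      rw [Multiset.sum_cons] at this
      omega
  by_contra! hlt
  rcases (by omega : (S.filter (· < 0)).card = M ∧ m ≤ (S.filter (0 < ·)).card + 1 ∨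
    (S.filter (0 < ·)).card = m ∧ M ≤ (S.filter (· < 0)).card + 1) with ⟨h1, h2⟩ | ⟨h1, h2⟩
  · exact (gcd_eq_one_or_of_card_filter_neg_eq hM hS h0 hmM h1 h2).elim h00 h01
  · rw [← card_filter_neg_map_neg] at h1
    rw [← card_filter_pos_map_neg] at h2
    rw [Int.gcd_comm] at h00 h10
    refine (gcd_eq_one_or_of_card_filter_neg_eq hm hS.map_neg (zero_notMem_map_neg h0)
      ?_ h1 h2).elim h00 h10
    intro x hx
    obtain ⟨z, hz, rfl⟩ := Multiset.mem_map.1 hx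
    have := hmM z hz
    omega

lemma isMinZeroSum_replicate_add_replicate {a b : ℕ} (ha : 0 < a) (hb : 0 < b)
    (hab : Nat.Coprime a b) :
    IsMinZeroSum (Multiset.replicate b (a : ℤ) + Multiset.replicate a (-b : ℤ)) := by
  refine ⟨by simp [mul_comm], fun T hT hT0 hTS hsum => ?_⟩
  have hpos := Multiset.filter_le_filter (0 < ·) hT
  have hneg := Multiset.filter_le_filter (fun x => ¬ 0 < x) hT
  have hA : ∀ x ∈ Multiset.replicate b (a : ℤ), 0 < x := fun x hx => by
    rw [Multiset.eq_of_mem_replicate hx]; omega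
  have hB : ∀ x ∈ Multiset.replicate a (-b : ℤ), ¬ 0 < x := fun x hx => by
    rw [Multiset.eq_of_mem_replicate hx]; omega
  rw [Multiset.filter_add, Multiset.filter_eq_self.2 hA, Multiset.filter_eq_nil.2 hB,
    add_zero] at hpos
  rw [Multiset.filter_add, Multiset.filter_eq_nil.2 fun x hx => not_not.2 (hA x hx),
    Multiset.filter_eq_self.2 hB, zero_add] at hneg
  obtain ⟨i, hi, hTi⟩ := Multiset.le_replicate_iff.1 hpos
  obtain ⟨j, hj, hTj⟩ := Multiset.le_replicate_iff.1 hneg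
  have hT' := Multiset.filter_add_not (0 < ·) T
  rw [hTi, hTj] at hT'
  subst hT'
  have hij : i * a = j * b := by
    have : (i : ℤ) * a - j * b = 0 := by simpa [sub_eq_add_neg] using hsum
    zify; omega
  obtain ⟨c, rfl⟩ : b ∣ i := hab.symm.dvd_of_dvd_mul_right ⟨j, by rw [hij, mul_comm]⟩
  have hjc : j = c * a := Nat.eq_of_mul_eq_mul_right hb (by rw [← hij]; ring)
  have hc : c ≤ 1 := by by_contra! h; nlinarith
  interval_cases c
  · simp [hjc] at hT0
  · simp [hjc] at hTS

theorem stmt_13 (m M : ℕ) (hm : 0 < m) (hM : 0 < M) (h : rho m M = 2) :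
    (davenport m M : ℤ) = (m : ℤ) + (M : ℤ) - 2 := by
  have hnot : ∀ t t' : ℕ, t < 2 → t' ≤ t →
      Int.gcd ((M : ℤ) - (t' : ℤ)) ((m : ℤ) - ((t - t' : ℕ) : ℤ)) ≠ 1 := fun t t' ht ht' h1 =>
    Nat.notMem_of_lt_sInf (show t < rho m M by omega) ⟨t', ht', h1⟩
  have h00 : Int.gcd M m ≠ 1 := by simpa using hnot 0 0 (by omega) le_rfl
  have h01 : Int.gcd M (m - 1) ≠ 1 := by simpa using hnot 1 0 (by omega) (by omega)
  have h10 : Int.gcd (M - 1) m ≠ 1 := by simpa using hnot 1 1 (by omega) le_rfl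
  have hM3 : 3 ≤ M := by
    by_contra! hlt
    interval_cases M
    · simp at h00
    · norm_num at h10
  have hm3 : 3 ≤ m := by
    by_contra! hlt
    interval_cases m
    · simp at h00
    · norm_num at h01
  obtain ⟨t', ht', hgcd⟩ : ∃ t' : ℕ, t' ≤ 2 ∧
      Int.gcd ((M : ℤ) - (t' : ℤ)) ((m : ℤ) - ((2 - t' : ℕ) : ℤ)) = 1 := by
    have := Nat.sInf_mem (Nat.nonempty_of_pos_sInf (show 0 < rho m M by omega))
    rw [← rho, h] at this
    exact this
  have hD : davenport m M = m + M - 2 := by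
    refine IsGreatest.csSup_eq ⟨?_, ?_⟩
    · refine ⟨_, isMinZeroSum_replicate_add_replicate (a := M - t') (b := m - (2 - t'))
        (by omega) (by omega) ?_, fun x hx => ?_, ?_⟩
      · rw [← Nat.cast_sub (by omega), ← Nat.cast_sub (by omega), Int.gcd_natCast_natCast] at hgcd
        exact hgcd
      · rcases Multiset.mem_add.1 hx with hx | hx <;>
          rw [Multiset.eq_of_mem_replicate hx] <;> omega
      · simp only [Multiset.card_add, Multiset.card_replicate]
        omega
    · rintro n ⟨S, hS, hmM, rfl⟩
      have := card_le_of_isMinZeroSum (by omega) (by omega) h00 h01 h10 hS hmM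
      omega
  omega
end

section
/- Let m and M be positive integers with ρ(m,M) = 2. Then min(m,M) ≥ 6, and if min(m,M) = 6 then max(m,M) ≥ 10. Conversely, ρ(6,10) = 2. -/
theorem Int.gcd_prime_pow_eq_one_or_gcd_sub_one {p : ℕ} (hp : p.Prime) (k : ℕ) (a : ℤ) :
    Int.gcd a ((p ^ k : ℕ) : ℤ) = 1 ∨ Int.gcd (a - 1) ((p ^ k : ℕ) : ℤ) = 1 := by
  have coprime_of_not_dvd : ∀ b : ℤ, ¬ (p : ℤ) ∣ b → Int.gcd b ((p ^ k : ℕ) : ℤ) = 1 := by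
    intro b hb
    rw [← Int.isCoprime_iff_gcd_eq_one, Nat.cast_pow]
    exact ((Nat.prime_iff_prime_int.mp hp).coprime_iff_not_dvd.mpr hb).symm.pow_right
  by_contra! hne
  have ha : (p : ℤ) ∣ a := by_contra fun hd => hne.1 (coprime_of_not_dvd a hd)
  have ha' : (p : ℤ) ∣ a - 1 := by_contra fun hd => hne.2 (coprime_of_not_dvd (a - 1) hd)
  refine (Nat.prime_iff_prime_int.mp hp).not_dvd_one ?_
  simpa using dvd_sub ha ha'

theorem six_le_of_gcd_ne_one {n : ℕ} (hn : 0 < n) {a : ℤ} (h₀ : Int.gcd a n ≠ 1)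
    (h₁ : Int.gcd (a - 1) n ≠ 1) : 6 ≤ n := by
  have not_prime_pow : ∀ p k : ℕ, p.Prime → n ≠ p ^ k := by
    rintro p k hp rfl
    exact (Int.gcd_prime_pow_eq_one_or_gcd_sub_one hp k a).elim h₀ h₁
  by_contra! hlt
  interval_cases n
  · exact not_prime_pow 2 0 Nat.prime_two rfl
  · exact not_prime_pow 2 1 Nat.prime_two rfl
  · exact not_prime_pow 3 1 Nat.prime_three rfl
  · exact not_prime_pow 2 2 Nat.prime_two rfl
  · exact not_prime_pow 5 1 Nat.prime_five rfl

theorem gcd_ne_one_of_lt_rho {m M t t' : ℕ} (ht : t < rho m M) (ht' : t' ≤ t) :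
    Int.gcd ((M : ℤ) - (t' : ℤ)) ((m : ℤ) - ((t - t' : ℕ) : ℤ)) ≠ 1 :=
  fun hgcd => Nat.notMem_of_lt_sInf ht ⟨t', ht', hgcd⟩

theorem rho_six_ten : rho 6 10 = 2 := by
  refine le_antisymm (Nat.sInf_le ⟨1, by decide, by decide⟩) ?_
  refine le_csInf ⟨2, 1, by decide, by decide⟩ ?_
  rintro t ⟨t', ht', hgcd⟩
  by_contra! hlt
  interval_cases t <;> interval_cases t' <;> revert hgcd <;> decide

theorem stmt_16 (m M : ℕ) (hm : 0 < m) (hM : 0 < M) (h : rho m M = 2) :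
    6 ≤ min m M ∧ (min m M = 6 → 10 ≤ max m M) ∧ rho 6 10 = 2 := by
  have h₀ : Int.gcd (M : ℤ) m ≠ 1 := by
    simpa using gcd_ne_one_of_lt_rho (m := m) (M := M) (t := 0) (t' := 0) (by omega) le_rfl
  have hM₁ : Int.gcd ((M : ℤ) - 1) m ≠ 1 := by
    simpa using gcd_ne_one_of_lt_rho (m := m) (M := M) (t := 1) (t' := 1) (by omega) le_rfl
  have hm₁ : Int.gcd (M : ℤ) ((m : ℤ) - 1) ≠ 1 := by
    simpa using gcd_ne_one_of_lt_rho (m := m) (M := M) (t := 1) (t' := 0) (by omega) zero_le_one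
  have hm₆ : 6 ≤ m := six_le_of_gcd_ne_one hm h₀ hM₁
  have hM₆ : 6 ≤ M :=
    six_le_of_gcd_ne_one hM (a := m) (by rwa [Int.gcd_comm]) (by rwa [Int.gcd_comm])
  refine ⟨le_min hm₆ hM₆, fun hmin => ?_, rho_six_ten⟩
  by_contra! hmax
  obtain ⟨hm₁₀, hM₁₀⟩ := max_lt_iff.mp hmax
  clear h hmax
  interval_cases m <;> interval_cases M <;> revert h₀ hM₁ hm₁ hmin <;> decide
end

section
/- Let m and M be positive integers with ρ(m,M) = 3. Then min(m,M) ≥ 22, and if min(m,M) = 22 then max(m,M) ≥ 78. Conversely, ρ(22,78) = 3. -/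
lemma gcd_ne_one_of_add_lt_rho {m M a b : ℕ} (h : a + b < rho m M) :
    Int.gcd ((M : ℤ) - a) ((m : ℤ) - b) ≠ 1 := by
  intro hg
  refine absurd (Nat.sInf_le ?_) (not_le.mpr h)
  exact ⟨a, Nat.le_add_right a b, by simpa using hg⟩

lemma rho_eq_three {m M a b : ℕ} (hab : a + b = 3)
    (hg : Int.gcd ((M : ℤ) - a) ((m : ℤ) - b) = 1)
    (h : ∀ t < 3, ∀ c : ℕ, c < t + 1 → Int.gcd ((M : ℤ) - c) ((m : ℤ) - ((t - c : ℕ) : ℤ)) ≠ 1) :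
    rho m M = 3 := by
  have hmem : 3 ∈ {t : ℕ | ∃ t' : ℕ, t' ≤ t ∧
      Int.gcd ((M : ℤ) - (t' : ℤ)) ((m : ℤ) - ((t - t' : ℕ) : ℤ)) = 1} := by
    refine ⟨a, by omega, ?_⟩
    rwa [show 3 - a = b by omega]
  refine le_antisymm (Nat.sInf_le hmem) (le_csInf ⟨3, hmem⟩ ?_)
  rintro t ⟨c, hc, hct⟩
  by_contra hlt
  exact h t (by omega) c (by omega) hct

lemma Int.gcd_natCast_mod_sub (M k : ℕ) (a : ℤ) :
    Int.gcd (((M % k : ℕ) : ℤ) - a) k = Int.gcd ((M : ℤ) - a) k := by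
  have e : (M : ℤ) - a = ((M % k : ℕ) : ℤ) - a + k * ((M / k : ℕ) : ℤ) := by
    have := Nat.mod_add_div M k
    zify at this ⊢
    linarith
  rw [e, Int.gcd_add_mul_left_left]

lemma le_left_of_gcd_ne_one {m M : ℕ} (hm : 0 < m)
    (h : ∀ a b : ℕ, a + b < 3 → Int.gcd ((M : ℤ) - a) ((m : ℤ) - b) ≠ 1) : 22 ≤ m := by
  by_contra! hlt
  obtain ⟨k, rfl⟩ : ∃ k, m = k + 1 := ⟨m - 1, by omega⟩
  have key : ∀ k : ℕ, k < 21 →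
      ¬ ((∃ r : ℕ, r < k + 1 ∧
          ∀ a : ℕ, a < 3 → Int.gcd ((r : ℤ) - (a : ℤ)) ((k + 1 : ℕ) : ℤ) ≠ 1) ∧
        (k = 0 ∨ ∃ r : ℕ, r < k ∧
          ∀ a : ℕ, a < 2 → Int.gcd ((r : ℤ) - (a : ℤ)) (k : ℤ) ≠ 1)) := by
    decide +kernel
  refine key k (by omega) ⟨⟨M % (k + 1), Nat.mod_lt _ hm, fun a ha => ?_⟩, ?_⟩
  · rw [Int.gcd_natCast_mod_sub]
    simpa using h a 0 (by omega)
  · rcases Nat.eq_zero_or_pos k with hk | hk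
    · exact Or.inl hk
    refine Or.inr ⟨M % k, Nat.mod_lt _ hk, fun a ha => ?_⟩
    rw [Int.gcd_natCast_mod_sub]
    simpa using h a 1 (by omega)

lemma le_right_of_gcd_ne_one {M : ℕ} (hM : 22 ≤ M)
    (h : ∀ a b : ℕ, a + b < 3 → Int.gcd ((M : ℤ) - a) (((22 : ℕ) : ℤ) - b) ≠ 1) : 78 ≤ M := by
  by_contra! hlt
  have key : ∀ M : ℕ, M < 78 → 22 ≤ M → ¬ ∀ a : ℕ, a < 3 → ∀ b : ℕ, b < 3 - a →
      Int.gcd ((M : ℤ) - (a : ℤ)) (((22 : ℕ) : ℤ) - (b : ℤ)) ≠ 1 := by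
    decide +kernel
  exact key M hlt hM fun a _ b hb => h a b (by omega)

theorem stmt_17 (m M : ℕ) (hm : 0 < m) (hM : 0 < M) (h : rho m M = 3) :
    22 ≤ min m M ∧ (min m M = 22 → 78 ≤ max m M) ∧ rho 22 78 = 3 := by
  have h₁ (a b : ℕ) (hab : a + b < 3) : Int.gcd ((M : ℤ) - a) ((m : ℤ) - b) ≠ 1 :=
    gcd_ne_one_of_add_lt_rho (h ▸ hab)
  have h₂ (a b : ℕ) (hab : a + b < 3) : Int.gcd ((m : ℤ) - a) ((M : ℤ) - b) ≠ 1 := by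
    rw [Int.gcd_comm]
    exact h₁ b a (by omega)
  have hm22 := le_left_of_gcd_ne_one hm h₁
  have hM22 := le_left_of_gcd_ne_one hM h₂
  refine ⟨le_min hm22 hM22, fun hmin => ?_, ?_⟩
  · rcases min_choice m M with hc | hc
    · obtain rfl : m = 22 := hc.symm.trans hmin
      exact (le_right_of_gcd_ne_one hM22 h₁).trans (le_max_right _ _)
    · obtain rfl : M = 22 := hc.symm.trans hmin
      exact (le_right_of_gcd_ne_one hm22 h₂).trans (le_max_left _ _)
  · exact rho_eq_three (a := 1) (b := 2) rfl (by decide +kernel) (by decide +kernel)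
end

section
/- Let m and M be positive integers with ρ(m,M) ≥ 4. Then either min(m,M) ≥ 320, or min(m,M) ∈ {255, 286}; moreover, if min(m,M) ∈ {255, 286} then ρ(m,M) = 4. -/
theorem not_coprime_of_add_lt_rho {m M i j : ℕ} (h : i + j < rho m M) (hi : i ≤ m) (hj : j ≤ M) :
    ¬ Nat.Coprime (M - j) (m - i) := by
  intro hc
  refine Nat.notMem_of_lt_sInf h ⟨j, by omega, ?_⟩
  rw [Nat.add_sub_cancel, ← Nat.cast_sub hi, ← Nat.cast_sub hj, Int.gcd_natCast_natCast]
  exact hc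

theorem rho_comm (m M : ℕ) : rho m M = rho M m := by
  have key : ∀ m M t : ℕ, (∃ t' : ℕ, t' ≤ t ∧
      Int.gcd ((M : ℤ) - (t' : ℤ)) ((m : ℤ) - ((t - t' : ℕ) : ℤ)) = 1) →
      ∃ t' : ℕ, t' ≤ t ∧
        Int.gcd ((m : ℤ) - (t' : ℤ)) ((M : ℤ) - ((t - t' : ℕ) : ℤ)) = 1 := by
    rintro m M t ⟨t', ht, h⟩
    exact ⟨t - t', Nat.sub_le _ _, by rwa [Nat.sub_sub_self ht, Int.gcd_comm]⟩
  unfold rho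
  congr 1
  ext t
  exact ⟨key m M t, key M m t⟩

/-- The primes in the interval `[5, 320)`. -/
def primesFiveTo320 : Finset ℕ :=
  {5, 7, 11, 13, 17, 19, 23, 29, 31, 37, 41, 43, 47, 53, 59, 61, 67, 71, 73, 79, 83, 89, 97,
    101, 103, 107, 109, 113, 127, 131, 137, 139, 149, 151, 157, 163, 167, 173, 179, 181, 191,
    193, 197, 199, 211, 223, 227, 229, 233, 239, 241, 251, 257, 263, 269, 271, 277, 281, 283,
    293, 307, 311, 313, 317}

theorem mem_primesFiveTo320 {p : ℕ} (hp : p.Prime) (h5 : 5 ≤ p) (hlt : p < 320) :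
    p ∈ primesFiveTo320 := by
  have sieve : ∀ p < 320, 5 ≤ p → (∀ q ∈ [2, 3, 5, 7, 11, 13, 17], p % q = 0 → q = p) →
      p ∈ primesFiveTo320 := by
    decide +kernel
  refine sieve p hlt h5 fun q hq h0 => ?_
  refine (hp.eq_one_or_self_of_dvd q (Nat.dvd_of_mod_eq_zero h0)).resolve_left ?_
  rintro rfl
  simp at hq

/-- The shifts `j < w` for which `n` and `M - j` have neither `2` nor `3` as a common factor
(with `6` added to `M` so that the subtraction does not truncate for `j ≤ 6`). -/
def uncovered (n M w : ℕ) : Finset ℕ :=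
  (Finset.range w).filter fun j =>
    (n % 2 = 0 → (M + 6 - j) % 2 ≠ 0) ∧ (n % 3 = 0 → (M + 6 - j) % 3 ≠ 0)

theorem uncovered_mod_six (n M : ℕ) {w : ℕ} (hw : w ≤ 5) :
    uncovered n (M % 6) w = uncovered n M w := by
  refine Finset.filter_congr fun j hj => ?_
  have hj := Finset.mem_range.1 hj
  have h2 : (M % 6 + 6 - j) % 2 = (M + 6 - j) % 2 := by omega
  have h3 : (M % 6 + 6 - j) % 3 = (M + 6 - j) % 3 := by omega
  rw [h2, h3]

theorem card_uncovered_le {n M w : ℕ} (hn : 0 < n) (hlt : n < 320) (hw : w ≤ 5) (hM : w ≤ M)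
    (h : ∀ j < w, ¬ Nat.Coprime (M - j) n) :
    (uncovered n M w).card ≤ (primesFiveTo320.filter fun p => n % p = 0).card := by
  have key : ∀ j, j ∈ uncovered n M w → ∃ p : ℕ, p.Prime ∧ 5 ≤ p ∧ p ∣ M - j ∧ p ∣ n := by
    intro j hj
    obtain ⟨hjw, hj2, hj3⟩ := Finset.mem_filter.1 hj
    have hjw := Finset.mem_range.1 hjw
    obtain ⟨p, hp, hpM, hpn⟩ := Nat.Prime.not_coprime_iff_dvd.1 (h j hjw)
    refine ⟨p, hp, ?_, hpM, hpn⟩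
    by_contra! hp5
    have := hp.two_le
    interval_cases p
    · exact hj2 (by omega) (by omega)
    · exact hj3 (by omega) (by omega)
    · exact absurd hp (by norm_num)
  choose! f hf using key
  refine Finset.card_le_card_of_injOn f (fun j hj => ?_) (fun j hj k hk hjk => ?_)
  · obtain ⟨hp, h5, -, hpn⟩ := hf j hj
    exact Finset.mem_coe.2 (Finset.mem_filter.2
      ⟨mem_primesFiveTo320 hp h5 ((Nat.le_of_dvd hn hpn).trans_lt hlt),
        Nat.mod_eq_zero_of_dvd hpn⟩)
  · obtain ⟨-, h5, hj', -⟩ := hf j hj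
    obtain ⟨-, -, hk', -⟩ := hf k hk
    rw [← hjk] at hk'
    have hjw := Finset.mem_range.1 (Finset.mem_filter.1 hj).1
    have hkw := Finset.mem_range.1 (Finset.mem_filter.1 hk).1
    by_contra hne
    rcases Nat.lt_or_gt_of_ne hne with hl | hl
    · have := Nat.le_of_dvd (by omega) (Nat.dvd_sub hj' hk')
      omega
    · have := Nat.le_of_dvd (by omega) (Nat.dvd_sub hk' hj')
      omega

theorem five_le_of_four_le_rho {m M : ℕ} (hm : 0 < m) (h : 4 ≤ rho m M) : 5 ≤ m := by
  by_contra! hlt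
  refine not_coprime_of_add_lt_rho (m := m) (M := M) (i := m - 1) (j := 0) (by omega) (by omega) (by omega) ?_
  rw [Nat.sub_sub_self hm]
  exact Nat.coprime_one_right _

theorem eq_255_or_286_of_card_uncovered_le : ∀ m < 320, 5 ≤ m → ∀ r < 6,
    (∀ i < 4, (uncovered (m - i) r (4 - i)).card ≤
      (primesFiveTo320.filter fun p => (m - i) % p = 0).card) → m = 255 ∨ m = 286 := by
  decide +kernel

theorem card_uncovered_sub_le {m M i w : ℕ} (hw : w ≤ 5) (h : i + w ≤ rho m M) (hi : i < m)
    (hlt : m < 320) (hM : w ≤ M) :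
    (uncovered (m - i) M w).card ≤
      (primesFiveTo320.filter fun p => (m - i) % p = 0).card :=
  card_uncovered_le (by omega) (by omega) hw hM fun _ hj =>
    not_coprime_of_add_lt_rho (by omega) hi.le (by omega)

theorem eq_255_or_286_of_four_le_rho {m M : ℕ} (hm : 0 < m) (hmM : m ≤ M) (h : 4 ≤ rho m M)
    (hlt : m < 320) : m = 255 ∨ m = 286 := by
  have h5 := five_le_of_four_le_rho hm h
  refine eq_255_or_286_of_card_uncovered_le m hlt h5 (M % 6) (Nat.mod_lt _ (by norm_num))
    fun i hi => ?_
  rw [uncovered_mod_six _ _ (by omega)]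
  exact card_uncovered_sub_le (by omega) (by omega) (by omega) hlt (by omega)

theorem rho_le_four {m M : ℕ} (hmM : m ≤ M) (hm : m = 255 ∨ m = 286) : rho m M ≤ 4 := by
  by_contra! hlt
  rcases hm with rfl | rfl
  · have h := card_uncovered_sub_le (i := 2) (w := 3) (by omega) hlt (by omega) (by omega)
      (by omega)
    rw [← uncovered_mod_six _ _ (by omega)] at h
    have hr := Nat.mod_lt M (show 0 < 6 by norm_num)
    generalize M % 6 = r at h hr
    revert h
    revert r
    decide +kernel
  · have h := card_uncovered_sub_le (i := 3) (w := 2) (by omega) hlt (by omega) (by omega)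
      (by omega)
    rw [← uncovered_mod_six _ _ (by omega)] at h
    have hr := Nat.mod_lt M (show 0 < 6 by norm_num)
    generalize M % 6 = r at h hr
    revert h
    revert r
    decide +kernel

theorem stmt_18 (m M : ℕ) (hm : 0 < m) (hM : 0 < M) (h : 4 ≤ rho m M) :
    (320 ≤ min m M ∨ min m M = 255 ∨ min m M = 286) ∧
    ((min m M = 255 ∨ min m M = 286) → rho m M = 4) := by
  wlog hmM : m ≤ M generalizing m M
  · rw [min_comm, rho_comm]
    exact this M m hM hm (by rwa [rho_comm]) (by omega)
  rw [min_eq_left hmM]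
  exact ⟨(le_or_gt 320 m).imp_right (eq_255_or_286_of_four_le_rho hm hmM h),
    fun hmin => (rho_le_four hmM hmin).antisymm h⟩
end

section
/- Let m and M be positive integers with ρ(m,M) ≥ 4. Then, as real numbers, ρ(m,M) ≤ √(min(m,M) + 5) - 3. -/
/-- An exponential sum with `s.card` nonzero bases that vanishes at `s.card` consecutive integers
vanishes at every integer. -/
theorem exp_sum_eq_zero_of_consecutive {ι : Type*} [DecidableEq ι] (s : Finset ι) (b : ι → ℂ)
    (hb : ∀ i ∈ s, b i ≠ 0) (c : ι → ℂ) (N : ℤ)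
    (h : ∀ j : ℕ, j < s.card → ∑ i ∈ s, c i * b i ^ (N + j) = 0) (n : ℤ) :
    ∑ i ∈ s, c i * b i ^ n = 0 := by
  induction s using Finset.induction_on generalizing c n with
  | empty => simp
  | insert x s hx ih =>
    have hbx : b x ≠ 0 := hb x (Finset.mem_insert_self x s)
    have hbs : ∀ i ∈ s, b i ≠ 0 := fun i hi => hb i (Finset.mem_insert_of_mem hi)
    set f : ℤ → ℂ := fun n => ∑ i ∈ insert x s, c i * b i ^ n with hf
    have shift : ∀ k : ℤ, ∑ i ∈ s, (c i * (b i - b x)) * b i ^ k = f (k + 1) - b x * f k := by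
      intro k
      simp only [hf, Finset.sum_insert hx, mul_add, Finset.mul_sum]
      rw [zpow_add_one₀ hbx, add_sub_add_comm, ← Finset.sum_sub_distrib]
      rw [show c x * (b x ^ k * b x) - b x * (c x * b x ^ k) = 0 by ring, zero_add]
      refine Finset.sum_congr rfl fun i hi => ?_
      rw [zpow_add_one₀ (hbs i hi)]
      ring
    rw [Finset.card_insert_of_notMem hx] at h
    have step : ∀ k : ℤ, f (k + 1) = b x * f k := by
      intro k
      have := ih hbs (fun i => c i * (b i - b x)) (fun j hj => by
        rw [shift, add_assoc]
        have h1 : f (N + (j + 1)) = 0 := by simpa using h (j + 1) (by omega)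
        have h2 : f (N + j) = 0 := h j (by omega)
        rw [h1, h2]; simp) k
      rw [shift] at this
      exact sub_eq_zero.mp this
    have h0 : f N = 0 := by simpa using h 0 (by omega)
    change f n = 0
    induction n using Int.inductionOn' (b := N) with
    | zero => exact h0
    | succ k _ hk => rw [step, hk, mul_zero]
    | pred k _ hk =>
      have := step (k - 1)
      rw [sub_add_cancel, hk] at this
      exact (mul_eq_zero.mp this.symm).resolve_left hbx

theorem int_gcd_ne_one_iff_exists_primeFactor {m : ℕ} (hm : m ≠ 0) (n : ℤ) :
    Int.gcd n m ≠ 1 ↔ ∃ p ∈ m.primeFactors, (p : ℤ) ∣ n := by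
  rw [Int.gcd_eq_natAbs, Int.natAbs_natCast]
  change ¬ Nat.Coprime n.natAbs m ↔ _
  rw [Nat.Prime.not_coprime_iff_dvd]
  constructor
  · rintro ⟨p, hp, h1, h2⟩
    exact ⟨p, Nat.mem_primeFactors.mpr ⟨hp, h2, hm⟩, Int.natCast_dvd.mpr h1⟩
  · rintro ⟨p, hp, h⟩
    exact ⟨p, Nat.prime_of_mem_primeFactors hp, Int.natCast_dvd.mp h,
      Nat.dvd_of_mem_primeFactors hp⟩

/-- Among `2 ^ ω(m)` consecutive integers, at least one is coprime to `m`. -/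
theorem exists_coprime_of_two_pow_consecutive {m : ℕ} (hm : m ≠ 0) (N : ℤ) :
    ∃ j : ℕ, j < 2 ^ m.primeFactors.card ∧ Int.gcd (N + j) m = 1 := by
  by_contra! hcon
  set z : ℕ → ℂ := fun p => Complex.exp (2 * Real.pi * Complex.I / p) with hz
  have hz0 : ∀ p, z p ≠ 0 := fun p => Complex.exp_ne_zero _
  have hprod : ∀ n : ℤ, ∏ p ∈ m.primeFactors, (1 - z p ^ n) =
      ∑ t ∈ m.primeFactors.powerset, (-1) ^ t.card * (∏ p ∈ t, z p) ^ n := by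
    intro n
    simp only [sub_eq_add_neg]
    rw [Finset.prod_one_add]
    refine Finset.sum_congr rfl fun t _ => ?_
    rw [Finset.prod_neg, Finset.prod_zpow]
  have hzero : ∀ n : ℤ, ∏ p ∈ m.primeFactors, (1 - z p ^ n) = 0 ↔ Int.gcd n m ≠ 1 := by
    intro n
    rw [int_gcd_ne_one_iff_exists_primeFactor hm, Finset.prod_eq_zero_iff]
    refine exists_congr fun p => and_congr_right fun hp => ?_
    have hp0 : p ≠ 0 := (Nat.prime_of_mem_primeFactors hp).ne_zero
    rw [sub_eq_zero, eq_comm, (Complex.isPrimitiveRoot_exp p hp0).zpow_eq_one_iff_dvd]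
  have key := exp_sum_eq_zero_of_consecutive m.primeFactors.powerset (fun t => ∏ p ∈ t, z p)
    (fun t _ => Finset.prod_ne_zero_iff.mpr fun p _ => hz0 p) (fun t => (-1) ^ t.card) N
    (fun j hj => by
      rw [← hprod, hzero]
      exact hcon j (by rwa [Finset.card_powerset] at hj)) 1
  rw [← hprod, hzero] at key
  simp at key

theorem primorial_bound_of_card_primes (s : Finset ℕ) (hs : ∀ p ∈ s, p.Prime) :
    210 * 11 ^ s.card ≤ 11 ^ 4 * ∏ p ∈ s, p := by
  have hsmall : ∀ t ∈ ({2, 3, 5, 7} : Finset ℕ).powerset,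
      210 * 11 ^ t.card ≤ 11 ^ 4 * ∏ p ∈ t, p := by decide
  have hsub : s.filter (· < 11) ∈ ({2, 3, 5, 7} : Finset ℕ).powerset := by
    rw [Finset.mem_powerset]
    intro p hp
    obtain ⟨h1, h2⟩ := Finset.mem_filter.mp hp
    have := hs p h1
    interval_cases p <;> first | decide | (exfalso; revert this; norm_num)
  have hlarge : 11 ^ (s.filter (¬ · < 11)).card ≤ ∏ p ∈ s.filter (¬ · < 11), p :=
    Finset.pow_card_le_prod _ _ _ fun p hp => by simpa using (Finset.mem_filter.mp hp).2
  rw [← Finset.card_filter_add_card_filter_not (s := s) (· < 11),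
    ← Finset.prod_filter_mul_prod_filter_not s (· < 11), pow_add, ← mul_assoc, ← mul_assoc]
  exact Nat.mul_le_mul (hsmall _ hsub) hlarge

theorem primorial_bound_of_card_primeFactors {m : ℕ} (hm : m ≠ 0) :
    210 * 11 ^ m.primeFactors.card ≤ 11 ^ 4 * m :=
  (primorial_bound_of_card_primes _ fun _ => Nat.prime_of_mem_primeFactors).trans
    (Nat.mul_le_mul_left _ (Nat.le_of_dvd (Nat.pos_of_ne_zero hm) (Nat.prod_primeFactors_dvd m)))

theorem two_pow_add_two_sq_bound (k : ℕ) :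
    11 ^ 4 * (2 ^ (k + 5) + 2) ^ 2 ≤ 210 * 11 ^ (k + 5) := by
  induction k with
  | zero => norm_num
  | succ k ih =>
    rw [show k + 1 + 5 = (k + 5) + 1 by ring, pow_succ 2, pow_succ 11 (k + 5)]
    nlinarith [Nat.zero_le (2 ^ (k + 5))]

theorem exists_coprime_of_forall_residue {m r : ℕ} (hm : 0 < m)
    (h : ∀ c < m, ∃ i < r, Nat.gcd (c + i) m = 1) (N : ℤ) :
    ∃ i : ℕ, i < r ∧ Int.gcd (N + i) m = 1 := by
  have hm' : (0 : ℤ) < m := by exact_mod_cast hm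
  obtain ⟨c, hc⟩ := Int.eq_ofNat_of_zero_le (Int.emod_nonneg N hm'.ne')
  have hlt := Int.emod_lt_of_pos N hm'
  obtain ⟨i, hi, hg⟩ := h c (by omega)
  refine ⟨i, hi, ?_⟩
  have hN : N + i = ((c + i : ℕ) : ℤ) + m * (N / m) := by
    push_cast
    linarith [Int.emod_add_mul_ediv N m]
  rw [hN, Int.gcd_add_mul_left_left, Int.gcd_natCast_natCast, hg]

theorem residues_lt_59 : ∀ m < 59, m ≠ 30 → m ≠ 42 →
    ∀ c < m, ∃ i < 4, Nat.gcd (c + i) m = 1 := by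
  decide +kernel

theorem residues_lt_95 : ∀ m < 95, ∀ c < m, ∃ i < 6, Nat.gcd (c + i) m = 1 := by
  decide +kernel

theorem residues_lt_319 : ∀ m < 319, ∀ c < m, ∃ i < 12, Nat.gcd (c + i) m = 1 := by
  decide +kernel

/-- If no pair in the triangle of side `r ≥ 4` below `(M, m)` is coprime, then `m` is large. -/
theorem lower_bound_of_noncoprime_triangle {m r : ℕ} (M : ℤ) (hm : 0 < m) (hr : 4 ≤ r)
    (h : ∀ a b : ℕ, a + b < r → Int.gcd (M - a) ((m : ℤ) - b) ≠ 1) :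
    (r + 3) ^ 2 ≤ m + 5 := by
  have hrun : ∀ n ≤ r, ¬ ∃ i : ℕ, i < n ∧ Int.gcd ((M - n + 1) + i) m = 1 := by
    rintro n hn ⟨i, hi, hg⟩
    refine h (n - 1 - i) 0 (by omega) ?_
    convert hg using 2
    · omega
    · simp
  have hres : ∀ n ≤ r, ¬ ∀ c < m, ∃ i < n, Nat.gcd (c + i) m = 1 := fun n hn hc =>
    hrun n hn (exists_coprime_of_forall_residue hm hc _)
  have hpow : r < 2 ^ m.primeFactors.card := by
    by_contra! hle
    exact hrun _ hle (exists_coprime_of_two_pow_consecutive hm.ne' _)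
  have hprim := primorial_bound_of_card_primeFactors hm.ne'
  by_contra! hlt
  generalize m.primeFactors.card = k at hpow hprim
  have hcol : ∀ q : ℕ, 0 < q → (∀ c < q, ∃ i < 2, Nat.gcd (c + i) q = 1) → m ≠ q + 1 := by
    intro q hq hc hmq
    obtain ⟨i, hi, hg⟩ := exists_coprime_of_forall_residue hq hc (M - 1)
    refine h (1 - i) 1 (by omega) ?_
    convert hg using 2
    · omega
    · simp [hmq]
  rcases Nat.lt_or_ge k 5 with hk | hk
  · have hk3 : 3 ≤ k := by
      by_contra! hk'
      have : 2 ^ k ≤ 2 ^ 2 := Nat.pow_le_pow_right (by norm_num) (by omega)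
      omega
    interval_cases k
    · have : r < 8 := hpow
      rcases Nat.lt_or_ge r 6 with h6 | h6
      · exact hres 4 hr (residues_lt_59 m (by nlinarith)
          (hcol 29 (by norm_num) (by decide)) (hcol 41 (by norm_num) (by decide)))
      · exact hres 6 h6 (residues_lt_95 m (by nlinarith))
    · have hr16 : r < 16 := hpow
      have hm210 : 210 ≤ m := by omega
      have h12 : 12 ≤ r := by
        by_contra! hr12
        nlinarith
      exact hres 12 h12 (residues_lt_319 m (by nlinarith))
  · obtain ⟨j, rfl⟩ := Nat.exists_eq_add_of_le' hk
    have h1 := two_pow_add_two_sq_bound j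
    have h2 : (r + 3) ^ 2 ≤ (2 ^ (j + 5) + 2) ^ 2 := Nat.pow_le_pow_left (by omega) 2
    omega

theorem stmt_19 (m M : ℕ) (hm : 0 < m) (hM : 0 < M) (h : 4 ≤ rho m M) :
    (rho m M : ℝ) ≤ Real.sqrt ((min m M : ℝ) + 5) - 3 := by
  have htri : ∀ a b : ℕ, a + b < rho m M → Int.gcd ((M : ℤ) - a) ((m : ℤ) - b) ≠ 1 := by
    intro a b hab hg
    refine Nat.notMem_of_lt_sInf hab ⟨a, by omega, ?_⟩
    rwa [Nat.add_sub_cancel_left]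
  have h1 := lower_bound_of_noncoprime_triangle (M : ℤ) hm h htri
  have h2 := lower_bound_of_noncoprime_triangle (m : ℤ) hM h fun a b hab => by
    rw [Int.gcd_comm]
    exact htri b a (by omega)
  rw [le_sub_iff_add_le]
  apply Real.le_sqrt_of_sq_le
  rw [← min_add_add_right]
  exact le_min (by exact_mod_cast h1) (by exact_mod_cast h2)
end
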